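/- arXiv:0911.2791 — 3 statements merged into one kernel-verified Lean document; each statement's English description precedes it below -/
import Mathlib

section
/- Let n ≥ 1 and let (a_0, a_1, …, a_{2n}) be real numbers with a_{2k} ≠ 0 for every k. Let A_0 ∈ ℝ² and v ∈ ℝ² satisfy A_0 × v ≠ 0, set A_1 := A_0 + (a_0/(A_0 × v))·v (so that A_0 × A_1 = a_0), and inductively, for 1 ≤ k ≤ n, set P_k := A_{k−1} + ((a_{2k−2}+1)/a_{2k−2})·(A_k − A_{k−1}), Q_k := P_k + a_{2k−1}·A_k, and A_{k+1} := A_k + a_{2k}·(Q_k − A_k). Then for all 0 ≤ k ≤ n one has A_k × A_{k+1} = a_{2k}, and for all 1 ≤ k ≤ n one has (A_{k−1} − A_k) × (A_{k+1} − A_k) = a_{2k−2}·a_{2k−1}·a_{2k}; that is, the LLS-sequence of the broken line A_0A_1…A_{n+1} with respect to the origin is exactly (a_0, a_1, …, a_{2n}). -/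
/-- Oriented area of the parallelogram spanned by two vectors of `ℝ²`. -/
def cross (v w : ℝ × ℝ) : ℝ := v.1 * w.2 - v.2 * w.1

/-- The step `A ↦ B ↦ B + e • (P + b • B - B)`, with `P = A + ((c + 1) / c) • (B - A)` and
`c = A × B`, yields the edge element `e`. -/
theorem cross_step_edge (A B : ℝ × ℝ) (b c e : ℝ) (hc : c ≠ 0) (h : cross A B = c) :
    cross B (B + e • (((A + ((c + 1) / c) • (B - A)) + b • B) - B)) = e := by
  have hdiv : (c + 1) / c = 1 + c⁻¹ := by field_simp
  simp only [hdiv, cross, Prod.fst_add, Prod.snd_add, Prod.fst_sub, Prod.snd_sub,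
    Prod.smul_fst, Prod.smul_snd, smul_eq_mul] at h ⊢
  linear_combination e * c⁻¹ * h + e * mul_inv_cancel₀ hc

/-- The same step turns at `B` by the angle element `b`. -/
theorem cross_step_angle (A B : ℝ × ℝ) (b c e : ℝ) (h : cross A B = c) :
    cross (A - B) (B + e • (((A + ((c + 1) / c) • (B - A)) + b • B) - B) - B) = c * b * e := by
  simp only [cross, Prod.fst_add, Prod.snd_add, Prod.fst_sub, Prod.snd_sub,
    Prod.smul_fst, Prod.smul_snd, smul_eq_mul] at h ⊢
  linear_combination b * e * h

/-- **Construction of a broken line from the elements of a continued fraction.**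
Given `n ≥ 1`, reals `a 0, …, a (2n)` with all even-indexed elements nonzero,
a starting point `A₀` and a direction `v` with `A₀ × v ≠ 0`, define
`A 1 = A₀ + (a 0 / (A₀ × v)) • v`, and for `1 ≤ k ≤ n`
`P k = A (k-1) + ((a (2k-2) + 1)/a (2k-2)) • (A k - A (k-1))`,
`Q k = P k + a (2k-1) • A k`, `A (k+1) = A k + a (2k) • (Q k - A k)`.
Then `A k × A (k+1) = a (2k)` for `0 ≤ k ≤ n` and
`(A (k-1) - A k) × (A (k+1) - A k) = a (2k-2) * a (2k-1) * a (2k)` for `1 ≤ k ≤ n`;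
i.e. the LLS-sequence of the broken line `A 0 A 1 … A (n+1)` with respect to the origin
is exactly `(a 0, a 1, …, a (2n))`. -/
theorem lls_of_constructed_broken_line
    (n : ℕ) (hn : 1 ≤ n) (a : ℕ → ℝ) (ha : ∀ k ≤ n, a (2 * k) ≠ 0)
    (A₀ v : ℝ × ℝ) (hv : cross A₀ v ≠ 0)
    (A : ℕ → ℝ × ℝ)
    (hA0 : A 0 = A₀)
    (hA1 : A 1 = A₀ + (a 0 / cross A₀ v) • v)
    (hrec : ∀ k, 1 ≤ k → k ≤ n →
      A (k + 1) = A k + a (2 * k) •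
        (((A (k - 1) + ((a (2 * k - 2) + 1) / a (2 * k - 2)) • (A k - A (k - 1)))
          + a (2 * k - 1) • A k) - A k)) :
    (∀ k ≤ n, cross (A k) (A (k + 1)) = a (2 * k)) ∧
    (∀ k, 1 ≤ k → k ≤ n →
      cross (A (k - 1) - A k) (A (k + 1) - A k)
        = a (2 * k - 2) * a (2 * k - 1) * a (2 * k)) := by
  have edge : ∀ k ≤ n, cross (A k) (A (k + 1)) = a (2 * k) := by
    intro k
    induction k with
    | zero =>
      intro _
      rw [hA0, zero_add, hA1]
      have key : cross A₀ (A₀ + (a 0 / cross A₀ v) • v) = a 0 / cross A₀ v * cross A₀ v := by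
        simp only [cross, Prod.fst_add, Prod.snd_add, Prod.smul_fst, Prod.smul_snd, smul_eq_mul]
        ring
      rw [key, div_mul_cancel₀ _ hv]
    | succ k ih =>
      intro hk
      rw [hrec (k + 1) (Nat.le_add_left 1 k) hk]
      exact cross_step_edge _ _ _ _ _ (ha k (by omega)) (ih (by omega))
  refine ⟨edge, fun k hk1 hkn => ?_⟩
  obtain ⟨k, rfl⟩ := Nat.exists_eq_add_of_le' hk1
  rw [hrec (k + 1) hk1 hkn]
  exact cross_step_angle _ _ _ _ _ (edge k (by omega))
end

section
/- Let A_0A_1…A_m (m ≥ 1) be a broken line in ℝ² with LLS-sequence (a_0, a_1, …, a_{2m−2}) with respect to the origin, and suppose A_0 = (1,0) and A_1 = (1, a_0) (i.e., the first edge is parallel to (0,1)). Then A_m = (q_{2m−2}, p_{2m−2}), where p_k, q_k are the continuants of the sequence (a_0, …, a_{2m−2}). -/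
/-- Edge elements of an LLS-sequence: `a (2k) = A k × A (k+1)`. -/
def edgeElem (A : ℕ → ℝ × ℝ) (k : ℕ) : ℝ := cross (A k) (A (k + 1))

/-- Angle elements of an LLS-sequence:
`a (2k-1) = ((A (k-1) - A k) × (A (k+1) - A k)) / (a (2k-2) * a (2k))`. -/
noncomputable def angleElem (A : ℕ → ℝ × ℝ) (k : ℕ) : ℝ :=
  cross (A (k - 1) - A k) (A (k + 1) - A k) / (edgeElem A (k - 1) * edgeElem A k)

/-- The LLS-sequence of a broken line `A` with respect to the origin:
`lls A (2k) = edgeElem A k` and `lls A (2k-1) = angleElem A k`. -/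
noncomputable def lls (A : ℕ → ℝ × ℝ) (j : ℕ) : ℝ :=
  if j % 2 = 0 then edgeElem A (j / 2) else angleElem A ((j + 1) / 2)

/-- Continuant numerators `p k` of a sequence `a`:
`p (-2) = 0`, `p (-1) = 1`, `p k = a k * p (k-1) + p (k-2)`. -/
def contP (a : ℕ → ℝ) : ℕ → ℝ
  | 0 => a 0
  | 1 => a 1 * a 0 + 1
  | (k + 2) => a (k + 2) * contP a (k + 1) + contP a k

/-- Continuant denominators `q k` of a sequence `a`:
`q (-2) = 1`, `q (-1) = 0`, `q k = a k * q (k-1) + q (k-2)`. -/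
def contQ (a : ℕ → ℝ) : ℕ → ℝ
  | 0 => 1
  | 1 => a 1
  | (k + 2) => a (k + 2) * contQ a (k + 1) + contQ a k

theorem lls_even (A : ℕ → ℝ × ℝ) (k : ℕ) : lls A (2 * k) = edgeElem A k := by
  simp [lls]

theorem lls_odd (A : ℕ → ℝ × ℝ) (k : ℕ) : lls A (2 * k + 1) = angleElem A (k + 1) := by
  have h₁ : (2 * k + 1) % 2 ≠ 0 := by omega
  have h₂ : (2 * k + 1 + 1) / 2 = k + 1 := by omega
  rw [lls, if_neg h₁, h₂]

/-- The edge vectors `A (k+1) - A k`, divided by the edge elements, change from one edge to the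
next by the angle element times the common vertex. -/
theorem edge_recurrence (A : ℕ → ℝ × ℝ) (k : ℕ) (h₀ : edgeElem A k ≠ 0)
    (h₁ : edgeElem A (k + 1) ≠ 0) (v : ℝ × ℝ) (hv : A (k + 1) = A k + edgeElem A k • v) :
    A (k + 2) =
      A (k + 1) + edgeElem A (k + 1) • (angleElem A (k + 1) • A (k + 1) + v) := by
  have hangle : edgeElem A k * edgeElem A (k + 1) * angleElem A (k + 1) =
      cross (A k - A (k + 1)) (A (k + 2) - A (k + 1)) :=
    mul_div_cancel₀ _ (mul_ne_zero h₀ h₁)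
  have hv₁ := congrArg Prod.fst hv
  have hv₂ := congrArg Prod.snd hv
  have he₀ : edgeElem A k = (A k).1 * (A (k + 1)).2 - (A k).2 * (A (k + 1)).1 := rfl
  have he₁ : edgeElem A (k + 1) =
      (A (k + 1)).1 * (A (k + 2)).2 - (A (k + 1)).2 * (A (k + 2)).1 := rfl
  simp only [cross, Prod.fst_sub, Prod.snd_sub, Prod.fst_add, Prod.snd_add, Prod.smul_fst,
    Prod.smul_snd, smul_eq_mul] at hangle hv₁ hv₂
  ext
  · simp only [Prod.fst_add, Prod.smul_fst, smul_eq_mul]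
    apply mul_left_cancel₀ h₀
    linear_combination (-(A (k + 1)).1) * hangle + edgeElem A (k + 1) * hv₁ +
      (A (k + 2)).1 * he₀ - (A (k + 1)).1 * he₀ + ((A k).1 - (A (k + 1)).1) * he₁
  · simp only [Prod.snd_add, Prod.smul_snd, smul_eq_mul]
    apply mul_left_cancel₀ h₀
    linear_combination (-(A (k + 1)).2) * hangle + edgeElem A (k + 1) * hv₂ +
      (A (k + 2)).2 * he₀ - (A (k + 1)).2 * he₀ + ((A k).2 - (A (k + 1)).2) * he₁

/-- Consecutive vertices of a broken line starting with `(1, 0)`, `(1, a 0)` differ by the edge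
element times the vector of odd-indexed continuants. -/
theorem vertex_and_edge_eq_continuants (A : ℕ → ℝ × ℝ) (hA0 : A 0 = (1, 0))
    (hA1 : A 1 = (1, lls A 0)) (k : ℕ) (hA : ∀ i ≤ k + 1, edgeElem A i ≠ 0) :
    A (k + 1) = (contQ (lls A) (2 * k), contP (lls A) (2 * k)) ∧
      A (k + 2) = A (k + 1) + edgeElem A (k + 1) •
        (contQ (lls A) (2 * k + 1), contP (lls A) (2 * k + 1)) := by
  induction k with
  | zero =>
    refine ⟨hA1, ?_⟩
    have he : lls A 0 = edgeElem A 0 := lls_even A 0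
    have ha : lls A 1 = angleElem A 1 := lls_odd A 0
    rw [edge_recurrence A 0 (hA 0 (by omega)) (hA 1 le_rfl) (0, 1) (by simp [hA0, hA1, he])]
    simp [contQ, contP, hA1, ha]
  | succ k ih =>
    obtain ⟨hvertex, hedge⟩ := ih fun i hi => hA i (by omega)
    have he : lls A (2 * k + 2) = edgeElem A (k + 1) := lls_even A (k + 1)
    have ha : lls A (2 * k + 3) = angleElem A (k + 2) := lls_odd A (k + 1)
    have hnext : A (k + 2) = (contQ (lls A) (2 * k + 2), contP (lls A) (2 * k + 2)) := by
      rw [hedge, hvertex]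
      ext <;> simp [contQ, contP, he] <;> ring
    refine ⟨hnext, ?_⟩
    rw [edge_recurrence A (k + 1) (hA _ (by omega)) (hA _ le_rfl) _ hedge]
    have hodd : (contQ (lls A) (2 * (k + 1) + 1), contP (lls A) (2 * (k + 1) + 1)) =
        angleElem A (k + 2) • A (k + 2) +
          (contQ (lls A) (2 * k + 1), contP (lls A) (2 * k + 1)) := by
      rw [hnext, ← ha]
      rfl
    rw [hodd]

/-- **Geometric meaning of continuants.**
Let `A 0 A 1 … A m` be a broken line with LLS-sequence `(a 0, …, a (2m-2))` with respect to
the origin, with `A 0 = (1,0)` and `A 1 = (1, a 0)`. Then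
`A m = (q (2m-2), p (2m-2))`, where `p`, `q` are the continuants of the LLS-sequence. -/
theorem endpoint_eq_continuants
    (m : ℕ) (hm : 1 ≤ m) (A : ℕ → ℝ × ℝ)
    (hA : ∀ k < m, cross (A k) (A (k + 1)) ≠ 0)
    (hA0 : A 0 = (1, 0))
    (hA1 : A 1 = (1, lls A 0)) :
    A m = (contQ (lls A) (2 * m - 2), contP (lls A) (2 * m - 2)) := by
  obtain _ | _ | k := m
  · omega
  · exact hA1
  · obtain ⟨hvertex, hedge⟩ := vertex_and_edge_eq_continuants A hA0 hA1 k
      fun i hi => hA i (by omega)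
    have he : lls A (2 * k + 2) = edgeElem A (k + 1) := lls_even A (k + 1)
    have hidx : 2 * (k + 1 + 1) - 2 = 2 * k + 2 := by omega
    rw [hidx, hedge, hvertex]
    ext <;> simp [contQ, contP, he] <;> ring
end

section
/- Let A_0A_1…A_m (m ≥ 1) be a broken line in ℝ² with LLS-sequence (a_0, a_1, …, a_{2m−2}) with respect to the origin, with A_0 = (1,0) and A_1 = (1, a_0). Write A_m = (x, y) and let p_k, q_k be the continuants of (a_0,…,a_{2m−2}). If q_{2m−2} ≠ 0, then x ≠ 0 and y/x = p_{2m−2}/q_{2m−2} = [a_0; a_1, …, a_{2m−2}] (the value of the corresponding continued fraction); if q_{2m−2} = 0 (the continued fraction has infinite value), then x = 0. -/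
theorem lls_two_mul (A : ℕ → ℝ × ℝ) (n : ℕ) : lls A (2 * n) = edgeElem A n := by
  simp [lls]

theorem lls_two_mul_add_one (A : ℕ → ℝ × ℝ) (n : ℕ) :
    lls A (2 * n + 1) = angleElem A (n + 1) := by
  have h₁ : (2 * n + 1) % 2 ≠ 0 := by omega
  have h₂ : (2 * n + 1 + 1) / 2 = n + 1 := by omega
  simp only [lls, if_neg h₁, h₂]

/-- Three consecutive vertices of a broken line are related through the elements of its
LLS-sequence. -/
theorem vertex_recurrence (A : ℕ → ℝ × ℝ) (n : ℕ) (h₀ : edgeElem A n ≠ 0)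
    (h₁ : edgeElem A (n + 1) ≠ 0) :
    A (n + 2) = A (n + 1) + edgeElem A (n + 1) •
      (angleElem A (n + 1) • A (n + 1) + (edgeElem A n)⁻¹ • (A (n + 1) - A n)) := by
  simp only [angleElem, Nat.add_sub_cancel]
  ext <;>
  · simp only [Prod.fst_add, Prod.snd_add, Prod.smul_fst, Prod.smul_snd, Prod.fst_sub,
      Prod.snd_sub, smul_eq_mul]
    field_simp
    simp only [edgeElem, cross, Prod.fst_sub, Prod.snd_sub]
    ring

/-- The vertices of a normalised broken line, and the rescaled edge directions, are the
continuants of its LLS-sequence. -/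
theorem vertex_eq_continuants (A : ℕ → ℝ × ℝ) (hA0 : A 0 = (1, 0)) (hA1 : A 1 = (1, lls A 0))
    (n : ℕ) (hA : ∀ k ≤ n, edgeElem A k ≠ 0) :
    A (n + 1) = (contQ (lls A) (2 * n), contP (lls A) (2 * n)) ∧
      angleElem A (n + 1) • A (n + 1) + (edgeElem A n)⁻¹ • (A (n + 1) - A n) =
        (contQ (lls A) (2 * n + 1), contP (lls A) (2 * n + 1)) := by
  induction n with
  | zero =>
    have h₀ : edgeElem A 0 ≠ 0 := hA 0 le_rfl
    have ha : lls A 0 = edgeElem A 0 := lls_two_mul A 0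
    have hb : lls A 1 = angleElem A 1 := lls_two_mul_add_one A 0
    refine ⟨by simpa [contQ, contP] using hA1, ?_⟩
    ext <;> simp [hA0, hA1, contQ, contP, ha, hb, h₀]
  | succ n ih =>
    obtain ⟨hv, hd⟩ := ih fun k hk => hA k (by omega)
    have h₁ : edgeElem A (n + 1) ≠ 0 := hA _ le_rfl
    have hr := vertex_recurrence A n (hA n (by omega)) h₁
    have hv' : A (n + 2) = (contQ (lls A) (2 * (n + 1)), contP (lls A) (2 * (n + 1))) := by
      have ha := lls_two_mul A (n + 1)
      rw [hr, hd, hv]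
      simp only [mul_add, mul_one] at ha ⊢
      ext <;> simp [contQ, contP, ha, add_comm (edgeElem A (n + 1) * _)]
    refine ⟨hv', ?_⟩
    have hb : lls A (2 * n + 1 + 2) = angleElem A (n + 2) := lls_two_mul_add_one A (n + 1)
    have hs : (edgeElem A (n + 1))⁻¹ • (A (n + 2) - A (n + 1)) =
        (contQ (lls A) (2 * n + 1), contP (lls A) (2 * n + 1)) := by
      rw [hr, add_sub_cancel_left, inv_smul_smul₀ h₁, hd]
    rw [hs, hv', show 2 * (n + 1) + 1 = 2 * n + 1 + 2 by ring]
    ext <;> simp [contQ, contP, hb, mul_add]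

/-- **Geometric meaning of corresponding continued fractions.**
Let `A 0 A 1 … A m` be a broken line with LLS-sequence `(a 0, …, a (2m-2))` with respect to
the origin, with `A 0 = (1,0)` and `A 1 = (1, a 0)`, and write `A m = (x, y)`.
If `q (2m-2) ≠ 0` then `x ≠ 0` and `y / x = p (2m-2) / q (2m-2)`, the value of the
corresponding continued fraction `[a 0; a 1, …, a (2m-2)]`;
if `q (2m-2) = 0` (the continued fraction has infinite value) then `x = 0`. -/
theorem endpoint_ratio_eq_continued_fraction
    (m : ℕ) (hm : 1 ≤ m) (A : ℕ → ℝ × ℝ)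
    (hA : ∀ k < m, cross (A k) (A (k + 1)) ≠ 0)
    (hA0 : A 0 = (1, 0))
    (hA1 : A 1 = (1, lls A 0)) :
    (contQ (lls A) (2 * m - 2) ≠ 0 →
      (A m).1 ≠ 0 ∧
      (A m).2 / (A m).1 = contP (lls A) (2 * m - 2) / contQ (lls A) (2 * m - 2)) ∧
    (contQ (lls A) (2 * m - 2) = 0 → (A m).1 = 0) := by
  obtain ⟨n, rfl⟩ : ∃ n, m = n + 1 := ⟨m - 1, by omega⟩
  have hv := (vertex_eq_continuants A hA0 hA1 n fun k hk => hA k (by omega)).1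
  rw [show 2 * (n + 1) - 2 = 2 * n by omega, hv]
  exact ⟨fun h => ⟨h, rfl⟩, id⟩
end
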